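/- arXiv:2512.15890 — 2 statements merged into one kernel-verified Lean document; each statement's English description precedes it below -/
import Mathlib

section
/- Let Φ be an N×2N complex matrix and let A_R, B_R ⊆ {N+1,…,2N} with |A_R| + |B_R| = N. If A_R ∩ B_R ≠ ∅, then ψ(A_R, B_R) = 0. -/
open Matrix

/-- The `N × N` matrix whose `m`-th column is the column of `Φ` indexed by the
`m`-th entry of the list `lst` (columns beyond the length of the list are padded
with zeros; no padding occurs when `lst` has length `N`). -/
def listMat {N L : ℕ} (Φ : Matrix (Fin N) (Fin L) ℂ) (lst : List (Fin L)) :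
    Matrix (Fin N) (Fin N) ℂ :=
  fun i m => if h : (m : ℕ) < lst.length then Φ i (lst.get ⟨m, h⟩) else 0

/-- The Slater determinant `Δ_S = det Φ_S`, where the columns of `S` are taken
in increasing order (intended for `|S| = N`). -/
def slater {N L : ℕ} (Φ : Matrix (Fin N) (Fin L) ℂ) (S : Finset (Fin L)) : ℂ :=
  (listMat Φ (S.sort (· ≤ ·))).det

/-- For disjoint finite sets `C`, `D`, the sign `(−1)^m` where
`m = #{(c,d) ∈ C × D : c > d}`. -/
def pairSgn {L : ℕ} (C D : Finset (Fin L)) : ℂ :=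
  (-1) ^ ((C ×ˢ D).filter (fun p => p.2 < p.1)).card

/-- The set `{1,…,N}` of the first `N` sites, inside `Fin (2N)`. -/
def firstHalf (N : ℕ) : Finset (Fin (2 * N)) :=
  Finset.univ.filter (fun i => (i : ℕ) < N)

/-- The set `{N+1,…,2N}` of the last `N` sites, inside `Fin (2N)`. -/
def secondHalf (N : ℕ) : Finset (Fin (2 * N)) :=
  Finset.univ.filter (fun i => N ≤ (i : ℕ))

/-- The post-measurement wavefunction
`ψ(A_R, B_R) = Σ_{A_L ⊆ {1,…,N}, |A_L| = N − |A_R|}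
(−1)^{|A_R|·|B_L|} · sgn(A_L, B_L) · Δ_{A_L ∪ A_R} · Δ_{B_L ∪ B_R}`,
where `B_L = {1,…,N} \ A_L`. -/
noncomputable def psi {N : ℕ} (Φ : Matrix (Fin N) (Fin (2 * N)) ℂ)
    (AR BR : Finset (Fin (2 * N))) : ℂ :=
  ∑ AL ∈ (firstHalf N).powersetCard (N - AR.card),
    (-1 : ℂ) ^ (AR.card * (firstHalf N \ AL).card) *
      pairSgn AL (firstHalf N \ AL) *
      slater Φ (AL ∪ AR) * slater Φ ((firstHalf N \ AL) ∪ BR)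

/-- Fixing the arguments of an alternating map in the right summand of its index type leaves an
alternating map in the remaining arguments. -/
def AlternatingMap.fixRight {R M M' ι κ : Type*} [CommSemiring R] [AddCommMonoid M]
    [AddCommMonoid M'] [Module R M] [Module R M'] (f : M [⋀^ι ⊕ κ]→ₗ[R] M') (w : κ → M) :
    M [⋀^ι]→ₗ[R] M' where
  toFun u := f (Sum.elim u w)
  map_update_add' u i x y := by
    classical
    simp only [← Sum.update_elim_inl, f.map_update_add]
  map_update_smul' u i c x := by
    classical
    simp only [← Sum.update_elim_inl, f.map_update_smul]
  map_eq_zero_of_eq' u i j h hij :=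
    f.map_eq_zero_of_eq _ (i := .inl i) (j := .inl j) (by simpa using h) (by simpa using hij)

theorem AlternatingMap.fixRight_eq_zero {R M M' ι κ : Type*} [CommSemiring R] [AddCommMonoid M]
    [AddCommMonoid M'] [Module R M] [Module R M'] (f : M [⋀^ι ⊕ κ]→ₗ[R] M') {w : κ → M}
    {u : ι → M} {i : ι} {k : κ} (h : u i = w k) : f.fixRight w u = 0 :=
  f.map_eq_zero_of_eq _ (i := .inl i) (j := .inr k) h (by simp)

/-- A nonzero vector belongs to a basis indexed by any type of the right cardinality. -/
theorem Module.Basis.exists_apply_eq_of_ne_zero {K V ι : Type*} [Field K] [AddCommGroup V]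
    [Module K V] [FiniteDimensional K V] [Fintype ι] (hι : Fintype.card ι = Module.finrank K V)
    {x : V} (hx : x ≠ 0) : ∃ (b : Module.Basis ι K V) (i : ι), b i = x := by
  have hli : LinearIndepOn K id ({x} : Set V) := LinearIndepOn.singleton hx
  let b := Module.Basis.extend hli
  have : Fintype (hli.extend (Set.subset_univ _)) := FiniteDimensional.fintypeBasisIndex b
  have e : hli.extend (Set.subset_univ _) ≃ ι := Fintype.equivOfCardEq (by
    rw [hι, Module.finrank_eq_card_basis b])
  have hmem : x ∈ hli.extend (Set.subset_univ _) :=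
    Module.Basis.subset_extend hli (Set.mem_singleton x)
  exact ⟨b.reindex e, e ⟨x, hmem⟩, by simp [b]⟩

/-- If `f` and `g` have a fixed argument in common, the shuffle product of the alternating maps
obtained by fixing it vanishes on top-degree arguments. -/
theorem AlternatingMap.domCoprod_fixRight_eq_zero {K V ι κ : Type*} [Field K]
    [AddCommGroup V] [Module K V] [FiniteDimensional K V] [Fintype ι] [Fintype κ]
    [DecidableEq ι] [DecidableEq κ]
    (hcard : Fintype.card (ι ⊕ κ) = Module.finrank K V)
    (f : V [⋀^ι ⊕ κ]→ₗ[K] K) (g : V [⋀^κ ⊕ ι]→ₗ[K] K) {w : κ → V} {w' : ι → V}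
    {k : κ} {i : ι} (h : w k = w' i) :
    (LinearMap.mul' K K).compAlternatingMap ((f.fixRight w).domCoprod (g.fixRight w')) = 0 := by
  by_cases hx : w k = 0
  · have : f.fixRight w = 0 := by
      ext u
      exact f.map_coord_zero (.inr k) hx
    rw [this, ← AlternatingMap.domCoprod'_apply]
    simp
  · obtain ⟨b, j, hb⟩ := Module.Basis.exists_apply_eq_of_ne_zero hcard hx
    rw [← AlternatingMap.map_basis_eq_zero_iff b]
    simp only [LinearMap.compAlternatingMap_apply, AlternatingMap.domCoprod_apply,
      _root_.sum_apply, map_sum]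
    refine Finset.sum_eq_zero fun σ _ => ?_
    induction σ using Quotient.inductionOn' with | _ σ
    rw [AlternatingMap.domCoprod.summand_mk'']
    suffices f.fixRight w (fun a => b (σ (.inl a))) * g.fixRight w' (fun a => b (σ (.inr a))) = 0 by
      simp [MultilinearMap.domCoprod_apply, this]
    rcases hs : σ.symm j with a | a
    · rw [AlternatingMap.fixRight_eq_zero f (i := a) (k := k), zero_mul]
      rw [← hs, Equiv.apply_symm_apply, hb]
    · rw [AlternatingMap.fixRight_eq_zero g (i := a) (k := i), mul_zero]
      rw [← hs, Equiv.apply_symm_apply, hb, h]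

theorem Finset.sort_union_of_lt {α : Type*} [LinearOrder α] {S T : Finset α}
    (h : ∀ s ∈ S, ∀ t ∈ T, s < t) :
    (S ∪ T).sort (· ≤ ·) = S.sort (· ≤ ·) ++ T.sort (· ≤ ·) := by
  have hd : Disjoint S T := Finset.disjoint_left.2 fun a ha hb => (h a ha a hb).false
  refine List.Perm.eq_of_pairwise (le := (· ≤ ·)) (fun a b _ _ => le_antisymm)
    (Finset.pairwise_sort _ _)
    (List.pairwise_append.2 ⟨Finset.pairwise_sort _ _, Finset.pairwise_sort _ _, ?_⟩) ?_
  · intro a ha b hb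
    exact (h a (by simpa using ha) b (by simpa using hb)).le
  · refine (List.perm_ext_iff_of_nodup (Finset.sort_nodup _ _) ?_).2 (by simp)
    exact (Finset.sort_nodup _ _).append (Finset.sort_nodup _ _) (by
      intro a ha hb
      exact Finset.disjoint_left.1 hd (by simpa using ha) (by simpa using hb))

/-- The Slater determinant of `S ∪ T`, with `S` below `T`, as the determinant of the vectors
indexed by `S` followed by those indexed by `T`. -/
theorem slater_union {N L m n : ℕ} (Φ : Matrix (Fin N) (Fin L) ℂ) {S T : Finset (Fin L)}
    (h : ∀ s ∈ S, ∀ t ∈ T, s < t) (hS : S.card = m) (hT : T.card = n) (hN : m + n = N) :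
    slater Φ (S ∪ T) =
      (detRowAlternating.domDomCongr (finSumFinEquiv.trans (finCongr hN)).symm)
        (Sum.elim (fun i => Φᵀ (S.orderEmbOfFin hS i)) (fun j => Φᵀ (T.orderEmbOfFin hT j))) := by
  subst hN
  rw [slater, ← det_transpose, AlternatingMap.domDomCongr_apply]
  refine congrArg Matrix.det ?_
  ext k i
  obtain ⟨k, rfl⟩ := finSumFinEquiv.surjective k
  rcases k with k | k
  · simp [listMat, Finset.sort_union_of_lt h, Finset.orderEmbOfFin_apply, hS, hT]
    omega
  · simp [listMat, Finset.sort_union_of_lt h, Finset.orderEmbOfFin_apply, hS, hT]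

/-- The sign of the permutation listing `A` and then its complement. -/
theorem sign_finSumEquivOfFinset {N p q : ℕ} (A : Finset (Fin N)) (hp : A.card = p)
    (hq : Aᶜ.card = q) (hN : p + q = N) :
    ((Equiv.Perm.sign ((finSumEquivOfFinset hp hq).trans
        (finSumFinEquiv.trans (finCongr hN)).symm) : ℤ) : ℂ) =
      pairSgn A Aᶜ := by
  subst hN
  have h1 : Equiv.Perm.sign ((finSumEquivOfFinset hp hq).trans finSumFinEquiv.symm) =
      Equiv.Perm.sign (finSumFinEquiv.symm.trans (finSumEquivOfFinset hp hq)) := by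
    rw [← Equiv.Perm.sign_symm_trans_trans _ finSumFinEquiv]
    congr 1
    ext x
    simp
  have h2 : Equiv.Perm.sign (finSumFinEquiv.symm.trans (finSumEquivOfFinset hp hq)) =
      (-1) ^ ((A ×ˢ Aᶜ).filter (fun p => p.2 < p.1)).card := by
    rw [Equiv.Perm.sign_eq_prod_prod_Iio, Finset.prod_sigma', Finset.prod_ite, Finset.prod_const_one,
      Finset.prod_const, one_mul]
    congr 1
    symm
    refine Finset.card_bij' (fun x _ =>
      ⟨finSumFinEquiv ((finSumEquivOfFinset hp hq).symm x.2),
        finSumFinEquiv ((finSumEquivOfFinset hp hq).symm x.1)⟩)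
      (fun y _ => (finSumEquivOfFinset hp hq (finSumFinEquiv.symm y.2),
        finSumEquivOfFinset hp hq (finSumFinEquiv.symm y.1)))
      ?_ ?_ (by simp) (by simp)
    · rintro ⟨a, b⟩ hab
      simp only [Finset.mem_filter, Finset.mem_product] at hab
      obtain ⟨⟨ha, hb⟩, hlt⟩ := hab
      have ha' : a ∈ Set.range (A.orderEmbOfFin hp) := by simpa using ha
      have hb' : b ∈ Set.range (Aᶜ.orderEmbOfFin hq) := by simpa using hb
      obtain ⟨i, rfl⟩ := ha'
      obtain ⟨j, rfl⟩ := hb'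
      rw [← finSumEquivOfFinset_inl hp hq, ← finSumEquivOfFinset_inr hp hq] at *
      simp only [Finset.mem_filter, Finset.mem_sigma, Equiv.symm_apply_apply]
      refine ⟨⟨Finset.mem_univ _, ?_⟩, ?_⟩
      · simp [Fin.lt_def]; omega
      · simpa using hlt.le
    · rintro ⟨a, b⟩ hab
      obtain ⟨a, rfl⟩ := finSumFinEquiv.surjective a
      obtain ⟨b, rfl⟩ := finSumFinEquiv.surjective b
      simp only [Finset.mem_filter, Finset.mem_sigma, Finset.mem_univ, Finset.mem_Iio, true_and,
        Equiv.trans_apply, Equiv.symm_apply_apply, not_lt] at hab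
      obtain ⟨hlt, hle⟩ := hab
      have hlt' := hle.lt_of_ne (by
        intro h
        have := (finSumEquivOfFinset hp hq).injective h
        simp [this] at hlt)
      rcases a with a | a <;> rcases b with b | b
      · simp at hlt hlt'; exact absurd hlt hlt'.asymm
      · simp [Fin.lt_def] at hlt; omega
      · simp only [Finset.mem_filter, Finset.mem_product, Equiv.symm_apply_apply]
        refine ⟨⟨?_, ?_⟩, hlt'⟩
        · simp
        · rw [finSumEquivOfFinset_inr]; exact Finset.orderEmbOfFin_mem _ _ _
      · simp at hlt hlt'; exact absurd hlt hlt'.asymm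
  have h3 : finSumFinEquiv.trans (finCongr (rfl : p + q = p + q)) = finSumFinEquiv := by
    ext; simp
  rw [h3, h1, h2, pairSgn]
  simp

/-- Every class of permutations modulo block permutations contains a unique shuffle. -/
theorem shuffle_bijective {N p q : ℕ} (e : Fin p ⊕ Fin q ≃ Fin N)
    (hq : ∀ A : {A : Finset (Fin N) // A.card = p}, A.1ᶜ.card = q) :
    Function.Bijective (fun A : {A : Finset (Fin N) // A.card = p} =>
      (Quotient.mk'' ((finSumEquivOfFinset A.2 (hq A)).trans e.symm) :
        Equiv.Perm.ModSumCongr (Fin p) (Fin q))) := by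
  constructor
  · rintro ⟨A, hA⟩ ⟨B, hB⟩ h
    have h' := QuotientGroup.leftRel_apply.1 (Quotient.exact' h)
    obtain ⟨⟨α, β⟩, hαβ⟩ := h'
    refine Subtype.ext (Finset.eq_of_subset_of_card_le (s := B) (t := A)
      (fun a ha => ?_) (hA.trans hB.symm).le).symm
    have ha' : a ∈ Set.range (B.orderEmbOfFin hB) := by simpa using ha
    obtain ⟨i, rfl⟩ := ha'
    have h1 := Equiv.ext_iff.1 (eq_inv_mul_iff_mul_eq.1 hαβ) (Sum.inl i)
    simp at h1
    rw [← h1]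
    exact Finset.orderEmbOfFin_mem _ _ _
  · intro σ
    induction σ using Quotient.inductionOn' with | _ σ
    let f : Fin p ↪ Fin N := ⟨fun i => e (σ (.inl i)),
      e.injective.comp (σ.injective.comp Sum.inl_injective)⟩
    let A : {A : Finset (Fin N) // A.card = p} := ⟨Finset.univ.map f, by simp⟩
    refine ⟨A, Quotient.sound' (QuotientGroup.leftRel_apply.2 ?_)⟩
    refine Equiv.Perm.mem_sumCongrHom_range_of_perm_mapsTo_inl ?_
    rintro _ ⟨i, rfl⟩
    have hi : f i ∈ Set.range (A.1.orderEmbOfFin A.2) := by simp [A]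
    obtain ⟨j, hj⟩ := hi
    refine ⟨j, ?_⟩
    rw [Equiv.Perm.mul_apply, Equiv.Perm.eq_inv_iff_eq]
    simp [hj, f]

/-- The shuffle product of two alternating maps as a sum over the positions of the first block. -/
theorem AlternatingMap.domCoprod_eq_sum {K V : Type*} [Field K] [AddCommGroup V] [Module K V]
    {N p q : ℕ} (hN : p + q = N) (e : Fin p ⊕ Fin q ≃ Fin N)
    (a : V [⋀^Fin p]→ₗ[K] K) (b : V [⋀^Fin q]→ₗ[K] K) (v : Fin N → V) (F : Finset (Fin N) → K)
    (hF : ∀ (A : Finset (Fin N)) (hp : A.card = p) (hq : Aᶜ.card = q),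
      F A = ((Equiv.Perm.sign ((finSumEquivOfFinset hp hq).trans e.symm) : ℤ) : K) *
        (a (fun i => v (A.orderEmbOfFin hp i)) * b (fun j => v (Aᶜ.orderEmbOfFin hq j)))) :
    (LinearMap.mul' K K).compAlternatingMap (a.domCoprod b) (fun k => v (e k)) =
      ∑ A ∈ Finset.powersetCard p Finset.univ, F A := by
  have hq (A : {A : Finset (Fin N) // A.card = p}) : A.1ᶜ.card = q := by
    rw [Finset.card_compl, Fintype.card_fin, A.2, ← hN, Nat.add_sub_cancel_left]
  rw [Finset.sum_subtype (p := fun A => A.card = p) _ (by simp)]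
  simp only [LinearMap.compAlternatingMap_apply, AlternatingMap.domCoprod_apply,
    _root_.sum_apply, map_sum]
  refine ((shuffle_bijective e hq).sum_comp _).symm.trans (Finset.sum_congr rfl fun A _ => ?_)
  rw [AlternatingMap.domCoprod.summand_mk'', hF A.1 A.2 (hq A)]
  rcases Int.units_eq_one_or
    (Equiv.Perm.sign ((finSumEquivOfFinset A.2 (hq A)).trans e.symm)) with h | h <;>
  simp [h, MultilinearMap.domCoprod_apply]

theorem firstHalf_eq_map (N : ℕ) :
    firstHalf N = Finset.univ.map (Fin.castLEEmb (show N ≤ 2 * N by omega)) := by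
  ext i
  simp only [firstHalf, Finset.mem_filter, Finset.mem_univ, true_and, Finset.mem_map]
  exact ⟨fun h => ⟨⟨i, h⟩, rfl⟩, by rintro ⟨j, rfl⟩; exact j.2⟩

theorem pairSgn_map {M N : ℕ} (f : Fin M ↪o Fin N) (C D : Finset (Fin M)) :
    pairSgn (C.map f.toEmbedding) (D.map f.toEmbedding) = pairSgn C D := by
  unfold pairSgn
  refine congrArg _ (Finset.card_bij (fun x _ => (f x.1, f x.2)) ?_ ?_ ?_).symm
  · simp
  · simp +contextual [Prod.ext_iff]
  · rintro ⟨x, y⟩ h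
    simp only [Finset.mem_filter, Finset.mem_product, Finset.mem_map] at h
    obtain ⟨⟨⟨c, hc, rfl⟩, ⟨d, hd, rfl⟩⟩, hlt⟩ := h
    exact ⟨(c, d), by simpa [hc, hd] using hlt, rfl⟩

theorem Finset.orderEmbOfFin_map {α β : Type*} [LinearOrder α] [LinearOrder β] (f : α ↪o β)
    (s : Finset α) {k : ℕ} (h : s.card = k) (h' : (s.map f.toEmbedding).card = k) (i : Fin k) :
    (s.map f.toEmbedding).orderEmbOfFin h' i = f (s.orderEmbOfFin h i) := by
  refine (congrFun (Finset.orderEmbOfFin_unique h'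
    (f := fun i => f (s.orderEmbOfFin h i)) ?_ ?_) i).symm
  · simp
  · exact f.strictMono.comp (s.orderEmbOfFin h).strictMono

/-- for `A_R, B_R ⊆ {N+1,…,2N}` with `|A_R| + |B_R| = N`, if
`A_R ∩ B_R ≠ ∅` then `ψ(A_R, B_R) = 0`. -/
theorem psi_eq_zero_of_overlap {N : ℕ} (Φ : Matrix (Fin N) (Fin (2 * N)) ℂ)
    (AR BR : Finset (Fin (2 * N)))
    (hAR : AR ⊆ secondHalf N) (hBR : BR ⊆ secondHalf N)
    (hcard : AR.card + BR.card = N) (hover : AR ∩ BR ≠ ∅) :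
    psi Φ AR BR = 0 := by
  obtain ⟨x, hx⟩ := Finset.nonempty_iff_ne_empty.2 hover
  obtain ⟨hxA, hxB⟩ := Finset.mem_inter.1 hx
  have hN : BR.card + AR.card = N := by omega
  have hN' : AR.card + BR.card = N := hcard
  let c : Fin N ↪o Fin (2 * N) := Fin.castLEOrderEmb (by omega)
  let e := finSumFinEquiv.trans (finCongr hN)
  let f : (Fin N → ℂ) [⋀^Fin BR.card ⊕ Fin AR.card]→ₗ[ℂ] ℂ :=
    detRowAlternating.domDomCongr (finSumFinEquiv.trans (finCongr hN)).symm
  let g : (Fin N → ℂ) [⋀^Fin AR.card ⊕ Fin BR.card]→ₗ[ℂ] ℂ :=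
    detRowAlternating.domDomCongr (finSumFinEquiv.trans (finCongr hN')).symm
  have hlt (A : Finset (Fin N)) (B : Finset (Fin (2 * N))) (hB : B ⊆ secondHalf N) :
      ∀ s ∈ A.map c.toEmbedding, ∀ t ∈ B, s < t := by
    intro s hs t ht
    obtain ⟨i, -, rfl⟩ := Finset.mem_map.1 hs
    have := (Finset.mem_filter.1 (hB ht)).2
    exact Fin.lt_def.2 (i.2.trans_le this)
  have hfirst : firstHalf N = Finset.univ.map c.toEmbedding := firstHalf_eq_map N
  have hcompl (A : Finset (Fin N)) :
      firstHalf N \ A.map c.toEmbedding = Aᶜ.map c.toEmbedding := by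
    rw [hfirst, ← Finset.map_sdiff, Finset.compl_eq_univ_sdiff]
  have hterm (A : Finset (Fin N)) (hp : A.card = BR.card) (hq : Aᶜ.card = AR.card) :
      pairSgn A Aᶜ * (slater Φ (A.map c.toEmbedding ∪ AR) * slater Φ (Aᶜ.map c.toEmbedding ∪ BR)) =
        ((Equiv.Perm.sign ((finSumEquivOfFinset hp hq).trans e.symm) : ℤ) : ℂ) *
          (f.fixRight (fun j => Φᵀ (AR.orderEmbOfFin rfl j))
              (fun i => Φᵀ (c (A.orderEmbOfFin hp i))) *
            g.fixRight (fun j => Φᵀ (BR.orderEmbOfFin rfl j))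
              (fun i => Φᵀ (c (Aᶜ.orderEmbOfFin hq i)))) := by
    have hp' : (A.map c.toEmbedding).card = BR.card := by rw [Finset.card_map, hp]
    have hq' : (Aᶜ.map c.toEmbedding).card = AR.card := by rw [Finset.card_map, hq]
    rw [slater_union Φ (hlt A AR hAR) hp' rfl hN, slater_union Φ (hlt Aᶜ BR hBR) hq' rfl hN',
      sign_finSumEquivOfFinset A hp hq hN]
    simp only [Finset.orderEmbOfFin_map c _ hp, Finset.orderEmbOfFin_map c _ hq]
    rfl
  obtain ⟨k, hk⟩ : x ∈ Set.range (AR.orderEmbOfFin rfl) := by simpa using hxA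
  obtain ⟨i, hi⟩ : x ∈ Set.range (BR.orderEmbOfFin rfl) := by simpa using hxB
  have hzero := AlternatingMap.domCoprod_fixRight_eq_zero (by simp [hN]) f g
    (w := fun j => Φᵀ (AR.orderEmbOfFin rfl j)) (w' := fun j => Φᵀ (BR.orderEmbOfFin rfl j))
    (k := k) (i := i) (by rw [hk, hi])
  have hsum := AlternatingMap.domCoprod_eq_sum hN e _ _ (fun i => Φᵀ (c i)) _ hterm
  rw [hzero, AlternatingMap.zero_apply] at hsum
  have hsub : N - AR.card = BR.card := by omega
  rw [psi, hsub]
  nth_rw 1 [hfirst]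
  rw [Finset.powersetCard_map, Finset.sum_map]
  rw [← mul_zero ((-1 : ℂ) ^ (AR.card * AR.card)), hsum, Finset.mul_sum]
  refine Finset.sum_congr rfl fun A hA => ?_
  have hp := (Finset.mem_powersetCard.1 hA).2
  have hq : Aᶜ.card = AR.card := by rw [Finset.card_compl, Fintype.card_fin]; omega
  simp only [Finset.mapEmbedding_apply, RelEmbedding.coe_toEmbedding]
  rw [hcompl, pairSgn_map, Finset.card_map, hq]
  ring
end

section
/- Let Φ be an N×2N complex matrix. There exists a sign c ∈ {+1, −1}, independent of the partition, such that for every partition {N+1,…,2N} = A_R ⊔ B_R into disjoint subsets, ψ(A_R, B_R) = c · (−1)^{|B_R|} · sgn(A_R, B_R) · Δ_{{1,…,N}} · Δ_{{N+1,…,2N}}. -/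
open Matrix

theorem slater_eq_det {N L : ℕ} (Φ : Matrix (Fin N) (Fin L) ℂ) {S : Finset (Fin L)}
    (hS : S.card = N) :
    slater Φ S = (Matrix.of fun i m => Φ i (S.orderEmbOfFin hS m)).det := by
  unfold slater
  congr 1
  ext i m
  have h : (m : ℕ) < (S.sort (· ≤ ·)).length := by simp [hS]
  rw [listMat, dif_pos h]
  simp [Finset.orderEmbOfFin_apply]

theorem slater_mul_column {N L : ℕ} (Φ : Matrix (Fin N) (Fin L) ℂ) (d : Fin L → ℂ)
    {S : Finset (Fin L)} (hS : S.card = N) :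
    slater (Matrix.of fun i c => d c * Φ i c) S = (∏ c ∈ S, d c) * slater Φ S := by
  rw [slater_eq_det _ hS, slater_eq_det _ hS]
  have hprod : ∏ c ∈ S, d c = ∏ m, d (S.orderEmbOfFin hS m) := by
    conv_lhs => rw [← Finset.image_orderEmbOfFin_univ S hS]
    rw [Finset.prod_image fun x _ y _ h => (S.orderEmbOfFin hS).injective h]
  rw [hprod, ← Matrix.det_mul_row]
  rfl

theorem pairSgn_eq_prod {L : ℕ} (C D : Finset (Fin L)) :
    pairSgn C D = ∏ c ∈ C, ∏ d ∈ D, if d < c then (-1 : ℂ) else 1 := by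
  rw [← Finset.prod_product', pairSgn, Finset.prod_ite]
  simp

theorem pairSgn_union_left {L : ℕ} {C C' : Finset (Fin L)} (D : Finset (Fin L))
    (h : Disjoint C C') : pairSgn (C ∪ C') D = pairSgn C D * pairSgn C' D := by
  simp only [pairSgn_eq_prod, Finset.prod_union h]

theorem pairSgn_union_right {L : ℕ} (C : Finset (Fin L)) {D D' : Finset (Fin L)}
    (h : Disjoint D D') : pairSgn C (D ∪ D') = pairSgn C D * pairSgn C D' := by
  simp only [pairSgn_eq_prod, Finset.prod_union h, Finset.prod_mul_distrib]

theorem pairSgn_of_lt {L : ℕ} {C D : Finset (Fin L)} (h : ∀ c ∈ C, ∀ d ∈ D, c < d) :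
    pairSgn C D = 1 := by
  rw [pairSgn_eq_prod]
  exact Finset.prod_eq_one fun c hc => Finset.prod_eq_one fun d hd => by
    simp [(h c hc d hd).le]

theorem pairSgn_of_gt {L : ℕ} {C D : Finset (Fin L)} (h : ∀ c ∈ C, ∀ d ∈ D, d < c) :
    pairSgn C D = (-1) ^ (C.card * D.card) := by
  rw [pairSgn, Finset.filter_true_of_mem, Finset.card_product]
  rintro ⟨c, d⟩ hp
  rw [Finset.mem_product] at hp
  exact h c hp.1 d hp.2

theorem pairSgn_mul_self {L : ℕ} (C D : Finset (Fin L)) : pairSgn C D * pairSgn C D = 1 := by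
  rw [pairSgn, ← mul_pow]
  simp

/-- The sign of the shuffle permutation listing `S` and then its complement. -/
theorem sign_finSumEquivOfFinset_s10 {m n : ℕ} {S : Finset (Fin (m + n))}
    (hS : S.card = m) (hS' : Sᶜ.card = n) :
    ((Equiv.Perm.sign ((finSumEquivOfFinset hS hS').trans finSumFinEquiv.symm) : ℤ) : ℂ)
      = pairSgn S Sᶜ := by
  have hconj : Equiv.Perm.sign ((finSumEquivOfFinset hS hS').trans finSumFinEquiv.symm)
      = Equiv.Perm.sign (finSumFinEquiv.symm.trans (finSumEquivOfFinset hS hS')) := by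
    rw [← Equiv.Perm.sign_permCongr finSumFinEquiv]
    congr 1
    ext x
    simp [Equiv.permCongr_apply]
  have hprod : pairSgn S Sᶜ = ∏ i, ∏ j,
      if Sᶜ.orderEmbOfFin hS' j < S.orderEmbOfFin hS i then (-1 : ℂ) else 1 := by
    rw [pairSgn_eq_prod]
    conv_lhs => rw [← Finset.image_orderEmbOfFin_univ S hS,
      ← Finset.image_orderEmbOfFin_univ (Finset.image _ _)ᶜ (by simpa using hS')]
    rw [Finset.prod_image fun x _ y _ h => (S.orderEmbOfFin hS).injective h]
    refine Finset.prod_congr rfl fun i _ => ?_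
    rw [Finset.prod_image fun x _ y _ h => (Finset.orderEmbOfFin _ _).injective h]
    simp
  rw [hconj, Equiv.Perm.sign_eq_prod_prod_Ioi, hprod]
  simp only [← Finset.filter_lt_eq_Ioi, Finset.prod_filter]
  rw [Fin.prod_univ_add]
  simp only [Fin.prod_univ_add]
  have hne : ∀ i j, S.orderEmbOfFin hS i ≠ Sᶜ.orderEmbOfFin hS' j := fun i j h => by
    have h1 := S.orderEmbOfFin_mem hS i
    have h2 := Sᶜ.orderEmbOfFin_mem hS' j
    rw [← h] at h2
    exact Finset.mem_compl.1 h2 h1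
  have hflip : ∀ i j, (if S.orderEmbOfFin hS i < Sᶜ.orderEmbOfFin hS' j then (1 : ℂ) else -1)
      = if Sᶜ.orderEmbOfFin hS' j < S.orderEmbOfFin hS i then (-1 : ℂ) else 1 := fun i j => by
    rcases lt_or_gt_of_ne (hne i j) with h | h
    · simp [h, h.le]
    · simp [h, h.le]
  have hLR : ∀ (i : Fin m) (j : Fin n), Fin.castAdd n i < Fin.natAdd m j := fun i j => by
    simp [Fin.lt_def]; omega
  have hone : ∀ {p q : Prop} [Decidable p] [Decidable q], (p → q) →
      (if p then if q then (1 : ℤˣ) else -1 else 1) = 1 := by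
    intro p q _ _ h
    split_ifs <;> tauto
  have hLL : ∀ i j : Fin m, (if Fin.castAdd n i < Fin.castAdd n j then
      if (finSumFinEquiv.symm.trans (finSumEquivOfFinset hS hS')) (Fin.castAdd n i)
        < (finSumFinEquiv.symm.trans (finSumEquivOfFinset hS hS')) (Fin.castAdd n j)
      then (1 : ℤˣ) else -1 else 1) = 1 := fun i j => hone (by
    simp [(Fin.strictMono_castAdd n).lt_iff_lt])
  have hRR : ∀ i j : Fin n, (if Fin.natAdd m i < Fin.natAdd m j then
      if (finSumFinEquiv.symm.trans (finSumEquivOfFinset hS hS')) (Fin.natAdd m i)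
        < (finSumFinEquiv.symm.trans (finSumEquivOfFinset hS hS')) (Fin.natAdd m j)
      then (1 : ℤˣ) else -1 else 1) = 1 := fun i j => hone (by simp)
  simp only [hLL, hRR, hLR, (hLR _ _).not_gt, if_true, if_false, Finset.prod_const_one,
    one_mul, mul_one, Units.coe_prod, Int.cast_prod, ← hflip]
  refine Finset.prod_congr rfl fun i _ => Finset.prod_congr rfl fun j _ => ?_
  simp only [Equiv.trans_apply, finSumFinEquiv_symm_apply_castAdd,
    finSumFinEquiv_symm_apply_natAdd, finSumEquivOfFinset_inl, finSumEquivOfFinset_inr]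
  split_ifs <;> simp

/-- Laplace expansion of the determinant of two stacked `N × 2N` matrices along the
first `N` rows. -/
theorem det_stack_eq_sum_slater {N : ℕ} (X Y : Matrix (Fin N) (Fin (N + N)) ℂ) :
    (Matrix.of fun r c : Fin N ⊕ Fin N =>
        Matrix.fromRows X Y r (finSumFinEquiv c)).det
      = ∑ S ∈ (Finset.univ : Finset (Fin (N + N))).powersetCard N,
          pairSgn S Sᶜ * (slater X S * slater Y Sᶜ) := by
  classical
  let g : Equiv.Perm (Fin N ⊕ Fin N) → Finset (Fin (N + N)) := fun σ =>
    Finset.univ.image fun i => finSumFinEquiv (σ (Sum.inl i))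
  have hg : ∀ σ ∈ (Finset.univ : Finset (Equiv.Perm (Fin N ⊕ Fin N))),
      g σ ∈ (Finset.univ : Finset (Fin (N + N))).powersetCard N := by
    intro σ _
    rw [Finset.mem_powersetCard_univ, Finset.card_image_of_injective]
    · simp
    · exact finSumFinEquiv.injective.comp (σ.injective.comp Sum.inl_injective)
  rw [← Matrix.det_transpose, Matrix.det_apply', ← Finset.sum_fiberwise_of_maps_to hg]
  refine Finset.sum_congr rfl fun S hS => ?_
  rw [Finset.mem_powersetCard_univ] at hS
  have hS' : Sᶜ.card = N := by simp [Finset.card_compl, hS]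
  set e : Equiv.Perm (Fin N ⊕ Fin N) :=
    (finSumEquivOfFinset hS hS').trans finSumFinEquiv.symm with he
  have hel : ∀ i, finSumFinEquiv (e (Sum.inl i)) = S.orderEmbOfFin hS i := fun i => by simp [he]
  have her : ∀ i, finSumFinEquiv (e (Sum.inr i)) = Sᶜ.orderEmbOfFin hS' i := fun i => by
    simp [he]
  rw [← sign_finSumEquivOfFinset_s10 hS hS', ← he, slater_eq_det X hS, slater_eq_det Y hS',
    ← Matrix.det_transpose, ← Matrix.det_transpose (Matrix.of fun i m => Y i _),
    Matrix.det_apply', Matrix.det_apply', Finset.sum_mul_sum, ← Finset.sum_product',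
    Finset.mul_sum]
  symm
  refine Finset.sum_bij (fun (p : Equiv.Perm (Fin N) × Equiv.Perm (Fin N)) _ =>
    e * Equiv.Perm.sumCongr p.1 p.2) ?_ ?_ ?_ ?_
  · intro p _
    rw [Finset.mem_filter]
    refine ⟨Finset.mem_univ _, ?_⟩
    simp only [g, Equiv.Perm.mul_apply, Equiv.Perm.sumCongr_apply, Sum.map_inl, hel]
    conv_rhs => rw [← Finset.image_orderEmbOfFin_univ S hS]
    ext x
    simp only [Finset.mem_image, Finset.mem_univ, true_and]
    exact p.1.exists_congr_left.trans (by simp)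
  · intro p _ q _ h
    have := Equiv.Perm.sumCongrHom_injective (mul_left_cancel h :
      Equiv.Perm.sumCongrHom _ _ p = Equiv.Perm.sumCongrHom _ _ q)
    exact this
  · intro σ hσ
    rw [Finset.mem_filter] at hσ
    have hmaps : Set.MapsTo (e⁻¹ * σ : Equiv.Perm (Fin N ⊕ Fin N))
        (Set.range Sum.inl) (Set.range Sum.inl) := by
      rintro _ ⟨i, rfl⟩
      have hi : finSumFinEquiv (σ (Sum.inl i)) ∈ S := by
        rw [← hσ.2]
        exact Finset.mem_image_of_mem _ (Finset.mem_univ i)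
      rw [← Finset.image_orderEmbOfFin_univ S hS] at hi
      obtain ⟨k, -, hk⟩ := Finset.mem_image.1 hi
      refine ⟨k, ?_⟩
      rw [Equiv.Perm.mul_apply, Equiv.Perm.eq_inv_iff_eq]
      apply finSumFinEquiv.injective
      rw [hel, hk]
    obtain ⟨p, hp⟩ := Equiv.Perm.mem_sumCongrHom_range_of_perm_mapsTo_inl hmaps
    refine ⟨p, Finset.mem_univ _, ?_⟩
    change e * Equiv.Perm.sumCongrHom _ _ p = σ
    rw [hp, mul_inv_cancel_left]
  · intro p _
    rw [Fintype.prod_sum_type]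
    simp only [Equiv.Perm.sign_mul, Equiv.Perm.sign_sumCongr, Matrix.transpose_apply,
      Matrix.of_apply, Equiv.Perm.mul_apply, Equiv.Perm.sumCongr_apply, Sum.map_inl,
      Sum.map_inr, hel, her, Matrix.fromRows_apply_inl,
      Matrix.fromRows_apply_inr, Units.val_mul, Int.cast_mul]
    ring

/-- The identification of two copies of `Fin N` with the left and right halves of
`Fin (2 * N)`. -/
def halvesEquiv (N : ℕ) : Fin N ⊕ Fin N ≃ Fin (2 * N) :=
  finSumFinEquiv.trans (finCongr (two_mul N).symm)

theorem halvesEquiv_inl_val {N : ℕ} (i : Fin N) :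
    (halvesEquiv N (Sum.inl i) : ℕ) = i := by
  simp [halvesEquiv]

theorem halvesEquiv_inr_val {N : ℕ} (i : Fin N) :
    (halvesEquiv N (Sum.inr i) : ℕ) = N + i := by
  simp [halvesEquiv, add_comm]

theorem det_fromRows_halvesEquiv {N : ℕ} (X Y : Matrix (Fin N) (Fin (2 * N)) ℂ) :
    (Matrix.of fun r c : Fin N ⊕ Fin N => Matrix.fromRows X Y r (halvesEquiv N c)).det
      = ∑ S ∈ (Finset.univ : Finset (Fin (2 * N))).powersetCard N,
          pairSgn S Sᶜ * (slater X S * slater Y Sᶜ) := by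
  have key : ∀ (L : ℕ) (h : N + N = L) (X Y : Matrix (Fin N) (Fin L) ℂ),
      (Matrix.of fun r c : Fin N ⊕ Fin N =>
        Matrix.fromRows X Y r ((finSumFinEquiv.trans (finCongr h)) c)).det
      = ∑ S ∈ (Finset.univ : Finset (Fin L)).powersetCard N,
          pairSgn S Sᶜ * (slater X S * slater Y Sᶜ) := by
    rintro L rfl X Y
    exact det_stack_eq_sum_slater X Y
  exact key _ _ X Y

theorem mem_firstHalf {N : ℕ} {x : Fin (2 * N)} : x ∈ firstHalf N ↔ (x : ℕ) < N := by
  simp [firstHalf]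

theorem mem_secondHalf {N : ℕ} {x : Fin (2 * N)} : x ∈ secondHalf N ↔ N ≤ (x : ℕ) := by
  simp [secondHalf]

theorem card_firstHalf (N : ℕ) : (firstHalf N).card = N := by
  have : firstHalf N = Finset.univ.image fun i => halvesEquiv N (Sum.inl i) := by
    ext x
    obtain ⟨i | i, rfl⟩ := (halvesEquiv N).surjective x <;>
      simp [mem_firstHalf, halvesEquiv_inl_val, halvesEquiv_inr_val]
  rw [this, Finset.card_image_of_injective]
  · simp
  · exact (halvesEquiv N).injective.comp Sum.inl_injective

theorem compl_firstHalf (N : ℕ) : (firstHalf N)ᶜ = secondHalf N := by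
  ext x
  simp [mem_firstHalf, mem_secondHalf]

theorem card_secondHalf (N : ℕ) : (secondHalf N).card = N := by
  rw [← compl_firstHalf, Finset.card_compl, card_firstHalf, Fintype.card_fin]
  omega

theorem slater_firstHalf {N : ℕ} (Φ : Matrix (Fin N) (Fin (2 * N)) ℂ) :
    slater Φ (firstHalf N) = (Matrix.of fun i j => Φ i (halvesEquiv N (Sum.inl j))).det := by
  rw [slater_eq_det Φ (card_firstHalf N), ← Finset.orderEmbOfFin_unique (card_firstHalf N)
    (f := fun j => halvesEquiv N (Sum.inl j))]
  · simp [mem_firstHalf, halvesEquiv_inl_val]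
  · intro i j h
    simpa [Fin.lt_def, halvesEquiv_inl_val, -Fin.val_fin_lt] using h

theorem slater_secondHalf {N : ℕ} (Φ : Matrix (Fin N) (Fin (2 * N)) ℂ) :
    slater Φ (secondHalf N) = (Matrix.of fun i j => Φ i (halvesEquiv N (Sum.inr j))).det := by
  rw [slater_eq_det Φ (card_secondHalf N), ← Finset.orderEmbOfFin_unique (card_secondHalf N)
    (f := fun j => halvesEquiv N (Sum.inr j))]
  · simp [mem_secondHalf, halvesEquiv_inr_val]
  · intro i j h
    simpa [Fin.lt_def, halvesEquiv_inr_val, -Fin.val_fin_lt] using h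

theorem det_fromBlocks_same_left {m R : Type*} [Fintype m] [DecidableEq m] [CommRing R]
    (V U W : Matrix m m R) :
    (Matrix.fromBlocks V U V W).det = V.det * (W - U).det := by
  have : Matrix.fromBlocks V U V W
      = Matrix.fromBlocks 1 0 1 1 * Matrix.fromBlocks V U 0 (W - U) := by
    simp [Matrix.fromBlocks_multiply]
  rw [this, Matrix.det_mul, Matrix.det_fromBlocks_zero₁₂, Matrix.det_fromBlocks_zero₂₁]
  simp

section Partition

variable {N : ℕ} {AR BR : Finset (Fin (2 * N))}

theorem card_add_card_of_partition (hU : AR ∪ BR = secondHalf N) (hd : Disjoint AR BR) :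
    AR.card + BR.card = N := by
  rw [← Finset.card_union_of_disjoint hd, hU, card_secondHalf]

/-- The determinant of the two stacked copies of `Φ`, with the columns of `BR` erased in the
top copy and those of `AR` erased in the bottom copy. -/
theorem det_erased_stack (Φ : Matrix (Fin N) (Fin (2 * N)) ℂ)
    (hU : AR ∪ BR = secondHalf N) (hd : Disjoint AR BR) :
    (Matrix.of fun r c : Fin N ⊕ Fin N => Matrix.fromRows
        (Matrix.of fun i c => (if c ∈ BR then 0 else 1) * Φ i c)
        (Matrix.of fun i c => (if c ∈ AR then 0 else 1) * Φ i c) r (halvesEquiv N c)).det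
      = (-1) ^ AR.card * (slater Φ (firstHalf N) * slater Φ (secondHalf N)) := by
  have hmem : ∀ x, x ∈ AR ∨ x ∈ BR ↔ N ≤ (x : ℕ) := fun x => by
    rw [← Finset.mem_union, hU, mem_secondHalf]
  have hleft : ∀ j : Fin N, halvesEquiv N (Sum.inl j) ∉ AR ∧ halvesEquiv N (Sum.inl j) ∉ BR := by
    intro j
    rw [← not_or, hmem, halvesEquiv_inl_val]
    exact j.isLt.not_ge
  have hprod : ∏ c ∈ secondHalf N,
      ((if c ∈ AR then 0 else 1) - (if c ∈ BR then 0 else 1) : ℂ) = (-1) ^ AR.card := by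
    rw [← hU, Finset.prod_union hd, Finset.prod_congr rfl (g := fun _ => (-1 : ℂ)),
      Finset.prod_eq_one (s := BR), Finset.prod_const, mul_one]
    · intro c hc
      simp [hc, Finset.disjoint_right.1 hd hc]
    · intro c hc
      simp [hc, Finset.disjoint_left.1 hd hc]
  have hcol := slater_mul_column Φ
    (fun c => (if c ∈ AR then 0 else 1) - (if c ∈ BR then 0 else 1)) (card_secondHalf N)
  rw [hprod, slater_secondHalf (Matrix.of _)] at hcol
  rw [mul_left_comm, ← hcol, slater_firstHalf, ← Matrix.fromBlocks_toBlocks (Matrix.of _)]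
  convert det_fromBlocks_same_left (R := ℂ) (m := Fin N) _ _ _ using 3
  · ext i j
    simp [Matrix.toBlocks₁₁, Matrix.toBlocks₂₁, hleft]
  · ext i j
    simp [Matrix.toBlocks₁₁, hleft]
  · ext i j
    simp [Matrix.toBlocks₂₂, Matrix.toBlocks₁₂, sub_mul]

theorem pairSgn_mul_psi (Φ : Matrix (Fin N) (Fin (2 * N)) ℂ)
    (hU : AR ∪ BR = secondHalf N) (hd : Disjoint AR BR) :
    pairSgn AR BR * psi Φ AR BR = (Matrix.of fun r c : Fin N ⊕ Fin N => Matrix.fromRows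
        (Matrix.of fun i c => (if c ∈ BR then 0 else 1) * Φ i c)
        (Matrix.of fun i c => (if c ∈ AR then 0 else 1) * Φ i c) r (halvesEquiv N c)).det := by
  have hmem : ∀ x, x ∈ AR ∨ x ∈ BR ↔ N ≤ (x : ℕ) := fun x => by
    rw [← Finset.mem_union, hU, mem_secondHalf]
  have hnot : ∀ x, x ∈ AR → x ∉ BR := fun _ hx => Finset.disjoint_left.1 hd hx
  have hcard := card_add_card_of_partition hU hd
  have hAR : ∀ {AL : Finset (Fin (2 * N))}, AL ⊆ firstHalf N → Disjoint AL AR := by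
    intro AL hAL
    rw [Finset.disjoint_left]
    intro x hx hx'
    exact (mem_firstHalf.1 (hAL hx)).not_ge ((hmem x).1 (Or.inl hx'))
  have hBR : ∀ {AL : Finset (Fin (2 * N))}, AL ⊆ firstHalf N → Disjoint AL BR := by
    intro AL hAL
    rw [Finset.disjoint_left]
    intro x hx hx'
    exact (mem_firstHalf.1 (hAL hx)).not_ge ((hmem x).1 (Or.inr hx'))
  have hlt : ∀ {C D : Finset (Fin (2 * N))}, C ⊆ firstHalf N → D ⊆ secondHalf N →
      ∀ c ∈ C, ∀ d ∈ D, c < d := fun hC hD c hc d hdd =>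
    Fin.lt_def.2 ((mem_firstHalf.1 (hC hc)).trans_le (mem_secondHalf.1 (hD hdd)))
  have hAsub : AR ⊆ secondHalf N := hU ▸ Finset.subset_union_left
  have hBsub : BR ⊆ secondHalf N := hU ▸ Finset.subset_union_right
  rw [det_fromRows_halvesEquiv, psi, Finset.mul_sum]
  refine Finset.sum_of_injOn (fun AL => AL ∪ AR) ?_ ?_ ?_ ?_
  · intro C hC D hD h
    rw [Finset.mem_coe, Finset.mem_powersetCard] at hC hD
    rw [← Finset.union_sdiff_cancel_right (hAR hC.1), show C ∪ AR = D ∪ AR from h,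
      Finset.union_sdiff_cancel_right (hAR hD.1)]
  · intro C hC
    rw [Finset.mem_coe, Finset.mem_powersetCard] at hC
    rw [Finset.mem_coe, Finset.mem_powersetCard_univ, Finset.card_union_of_disjoint (hAR hC.1)]
    omega
  · intro S hS hS'
    rw [Finset.mem_powersetCard_univ] at hS
    have hSc : Sᶜ.card = N := by
      rw [Finset.card_compl, hS, Fintype.card_fin]; omega
    rw [slater_mul_column Φ _ hS, slater_mul_column Φ _ hSc]
    by_cases h1 : ∃ c ∈ S, c ∈ BR
    · obtain ⟨c, hc, hcB⟩ := h1
      rw [Finset.prod_eq_zero hc (by simp [hcB])]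
      simp
    by_cases h2 : ∃ c ∈ Sᶜ, c ∈ AR
    · obtain ⟨c, hc, hcA⟩ := h2
      rw [Finset.prod_eq_zero (s := Sᶜ) hc (by simp [hcA])]
      simp
    push Not at h1 h2
    have hsub : AR ⊆ S := fun x hx => by
      by_contra hxS
      exact h2 x (Finset.mem_compl.2 hxS) hx
    refine absurd ⟨S \ AR, ?_, Finset.sdiff_union_of_subset hsub⟩ hS'
    rw [Finset.mem_coe, Finset.mem_powersetCard, Finset.card_sdiff_of_subset hsub, hS]
    refine ⟨fun x hx => ?_, rfl⟩
    rw [Finset.mem_sdiff] at hx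
    rw [mem_firstHalf, ← not_le, ← hmem]
    exact not_or.2 ⟨hx.2, h1 x hx.1⟩
  · intro C hC
    rw [Finset.mem_powersetCard] at hC
    obtain ⟨hCsub, hCcard⟩ := hC
    have hS : (C ∪ AR).card = N := by
      rw [Finset.card_union_of_disjoint (hAR hCsub)]; omega
    have hSc : (C ∪ AR)ᶜ.card = N := by
      rw [Finset.card_compl, hS, Fintype.card_fin]; omega
    have hcompl : (C ∪ AR)ᶜ = (firstHalf N \ C) ∪ BR := by
      ext x
      have h1 := hmem x
      have h2 := hnot x
      have h3 : x ∈ C → (x : ℕ) < N := fun h => mem_firstHalf.1 (hCsub h)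
      simp only [Finset.mem_compl, Finset.mem_union, Finset.mem_sdiff, mem_firstHalf]
      grind
    have hDsub : firstHalf N \ C ⊆ firstHalf N := Finset.sdiff_subset
    have hone : ∏ c ∈ C ∪ AR, (if c ∈ BR then (0 : ℂ) else 1) = 1 := by
      refine Finset.prod_eq_one fun c hc => if_neg ?_
      rcases Finset.mem_union.1 hc with h | h
      · exact Finset.disjoint_left.1 (hBR hCsub) h
      · exact hnot c h
    have hone' : ∏ c ∈ (C ∪ AR)ᶜ, (if c ∈ AR then (0 : ℂ) else 1) = 1 :=
      Finset.prod_eq_one fun c hc => if_neg fun h =>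
        Finset.mem_compl.1 hc (Finset.mem_union_right _ h)
    rw [slater_mul_column Φ _ hS, slater_mul_column Φ _ hSc, hone, hone', hcompl,
      pairSgn_union_left _ (hAR hCsub), pairSgn_union_right _ (hBR hDsub),
      pairSgn_union_right _ (hBR hDsub), pairSgn_of_lt (hlt hCsub hBsub),
      pairSgn_of_gt (C := AR) (D := firstHalf N \ C)
        fun c hc d hdd => hlt hDsub hAsub d hdd c hc]
    ring

end Partition

/-- there exists a sign `c ∈ {+1, −1}`, independent of the
partition, such that for every partition `{N+1,…,2N} = A_R ⊔ B_R`,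
`ψ(A_R, B_R) = c · (−1)^{|B_R|} · sgn(A_R, B_R) · Δ_{{1,…,N}} · Δ_{{N+1,…,2N}}`. -/
theorem psi_universal_form {N : ℕ} (Φ : Matrix (Fin N) (Fin (2 * N)) ℂ) :
    ∃ c : ℂ, (c = 1 ∨ c = -1) ∧
      ∀ AR BR : Finset (Fin (2 * N)),
        AR ∪ BR = secondHalf N → Disjoint AR BR →
          psi Φ AR BR =
            c * (-1 : ℂ) ^ BR.card * pairSgn AR BR *
              slater Φ (firstHalf N) * slater Φ (secondHalf N) := by
  refine ⟨(-1) ^ N, neg_one_pow_eq_or ℂ N, fun AR BR hU hd => ?_⟩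
  have hsign : (-1 : ℂ) ^ N * (-1) ^ BR.card = (-1) ^ AR.card := by
    have hN : (-1 : ℂ) ^ N = (-1) ^ (AR.card + BR.card) := by
      rw [card_add_card_of_partition hU hd]
    rw [hN, pow_add, mul_assoc, ← mul_pow]
    simp
  have key := (pairSgn_mul_psi Φ hU hd).trans (det_erased_stack Φ hU hd)
  rw [hsign]
  linear_combination pairSgn AR BR * key - psi Φ AR BR * pairSgn_mul_self AR BR
end
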